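/- Let A = (Q, Σ, δ) be a partial Eulerian automaton with n states and let r be its minimal non-zero rank. Then there exists a word of rank r and of length at most (n − r)². -/

import Mathlib

open scoped Classical

section Defs

variable {Q A : Type*}

/-- Action of a word in a partial DFA with transition function `δ`
(`none` means the undefined value ⊥). -/
def stepWord (δ : Q → A → Option Q) : Q → List A → Option Q
  | q, [] => some q
  | q, a :: w => (δ q a).bind (fun p => stepWord δ p w)

/-- The image `δ(S, w)` of a set of states under the action of a word. -/
def img (δ : Q → A → Option Q) (S : Set Q) (w : List A) : Set Q :=
  {p | ∃ q ∈ S, stepWord δ q w = some p}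

/-- The inseparability equivalence `p ≡ q`. -/
def Insep (δ : Q → A → Option Q) (p q : Q) : Prop :=
  ∀ u : List A, (stepWord δ p u).isSome ↔ (stepWord δ q u).isSome

/-- `κ(S)`: the number of inseparability classes intersecting `S`. -/
noncomputable def kappa (δ : Q → A → Option Q) (S : Set Q) : ℕ :=
  {C : Set Q | ∃ p ∈ S, C = {q | Insep δ p q}}.ncard

def StronglyConnected (δ : Q → A → Option Q) : Prop :=
  ∀ p q : Q, ∃ w : List A, stepWord δ p w = some q

/-- The transition function of the fixing automaton `A^F`. -/
def fixDelta (δ : Q → A → Option Q) (q : Q) (a : A) : Q := (δ q a).getD q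

/-- Action of a word in a complete DFA. -/
def stepWordC (δc : Q → A → Q) (q : Q) (w : List A) : Q := w.foldl δc q

/-- The image of a set of states under the action of a word in a complete DFA. -/
def imgC (δc : Q → A → Q) (S : Set Q) (w : List A) : Set Q :=
  (fun q => stepWordC δc q w) '' S

end Defs

section ChainLemma

theorem Submodule.chain_stabilizes {V : Type*} [AddCommGroup V] [Module ℚ V]
    [FiniteDimensional ℚ V] (U : ℕ → Submodule ℚ V) (hmono : Monotone U)
    (hstab : ∀ k, U (k + 1) ≤ U k → U (k + 2) ≤ U (k + 1)) (d : ℕ) :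
    (∀ k, U k ≤ U d) ∨ Module.finrank ℚ (U 0) + d ≤ Module.finrank ℚ (U d) := by
  by_cases h : ∃ j < d, U (j + 1) ≤ U j
  · left
    obtain ⟨j, hj, hjs⟩ := h
    have h1 : ∀ i, U (j + i + 1) ≤ U (j + i) := by
      intro i
      induction i with
      | zero => exact hjs
      | succ i ih => exact hstab _ ih
    have h2 : ∀ i, U (j + i) ≤ U j := by
      intro i
      induction i with
      | zero => exact le_rfl
      | succ i ih => exact (h1 i).trans ih
    intro k
    exact (hmono (Nat.le_add_left k j)).trans ((h2 k).trans (hmono hj.le))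
  · right
    push Not at h
    have : ∀ i ≤ d, Module.finrank ℚ (U 0) + i ≤ Module.finrank ℚ (U i) := by
      intro i
      induction i with
      | zero => intro _; exact le_rfl
      | succ i ih =>
        intro hi
        have h1 := ih (by omega)
        have h2 : U i < U (i + 1) := lt_of_le_not_ge (hmono (Nat.le_succ i)) (h i (by omega))
        have := Submodule.finrank_lt_finrank_of_lt h2
        omega
    exact this d le_rfl

end ChainLemma

section Complete

variable {Q A : Type*}

theorem stepWordC_append (g : Q → A → Q) (q : Q) (u v : List A) :
    stepWordC g q (u ++ v) = stepWordC g (stepWordC g q u) v := by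
  simp [stepWordC]

variable [Fintype Q]

/-- The preimage of a finite set of states under the action of a word in a complete DFA. -/
noncomputable def preC (g : Q → A → Q) (w : List A) (S : Finset Q) : Finset Q :=
  Finset.univ.filter (fun q => stepWordC g q w ∈ S)

theorem mem_preC (g : Q → A → Q) (w : List A) (S : Finset Q) (q : Q) :
    q ∈ preC g w S ↔ stepWordC g q w ∈ S := by
  simp [preC]

theorem preC_append (g : Q → A → Q) (u v : List A) (S : Finset Q) :
    preC g (u ++ v) S = preC g u (preC g v S) := by
  ext q
  simp [mem_preC, stepWordC_append]

theorem preC_nil (g : Q → A → Q) (S : Finset Q) : preC g [] S = S := by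
  ext q
  simp [mem_preC, stepWordC]

theorem card_preC_eq_sum (g : Q → A → Q) (u : List A) (S : Finset Q) :
    (preC g u S).card = ∑ q ∈ S, (preC g u {q}).card := by
  rw [Finset.card_eq_sum_card_fiberwise (f := fun q => stepWordC g q u) (t := S)
    (fun q hq => by simpa [mem_preC] using hq)]
  refine Finset.sum_congr rfl fun q hq => ?_
  congr 1
  ext p
  simp only [Finset.mem_filter, mem_preC, Finset.mem_singleton]
  constructor
  · exact fun h => h.2
  · exact fun h => ⟨h ▸ hq, h⟩

/-- The vector of fibre sizes of the action of a word. -/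
noncomputable def fiberVec (g : Q → A → Q) (u : List A) : Q → ℚ :=
  fun q => ((preC g u {q}).card : ℚ)

/-- Push-forward of rational weights along the action of a word. -/
noncomputable def pushC (g : Q → A → Q) (w : List A) : (Q → ℚ) →ₗ[ℚ] (Q → ℚ) where
  toFun x q := ∑ p ∈ preC g w {q}, x p
  map_add' x y := by ext q; simp [Finset.sum_add_distrib]
  map_smul' c x := by ext q; simp [Finset.mul_sum]

theorem pushC_fiberVec (g : Q → A → Q) (u w : List A) :
    pushC g w (fiberVec g u) = fiberVec g (u ++ w) := by
  ext q
  simp only [pushC, LinearMap.coe_mk, AddHom.coe_mk, fiberVec]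
  rw [preC_append, card_preC_eq_sum g u (preC g w {q})]
  push_cast
  rfl

/-- The span of the deviations from uniformity of the fibre sizes of words of length at most
`k`. -/
noncomputable def devSpan (g : Q → A → Q) (k : ℕ) : Submodule ℚ (Q → ℚ) :=
  Submodule.span ℚ {x | ∃ u : List A, u.length ≤ k ∧ x = fiberVec g u - fiberVec g []}

theorem devSpan_mono (g : Q → A → Q) : Monotone (devSpan g) := by
  intro i j hij
  refine Submodule.span_mono ?_
  rintro x ⟨u, hu, rfl⟩
  exact ⟨u, hu.trans hij, rfl⟩

theorem mem_devSpan (g : Q → A → Q) {k : ℕ} {u : List A} (hu : u.length ≤ k) :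
    fiberVec g u - fiberVec g [] ∈ devSpan g k :=
  Submodule.subset_span ⟨u, hu, rfl⟩

theorem pushC_mem_devSpan (g : Q → A → Q) (a : A) (k : ℕ) (x : Q → ℚ) (hx : x ∈ devSpan g k) :
    pushC g [a] x ∈ devSpan g (k + 1) := by
  have : devSpan g k ≤ (devSpan g (k + 1)).comap (pushC g [a]) := by
    refine Submodule.span_le.2 ?_
    rintro x ⟨u, hu, rfl⟩
    simp only [Submodule.comap_coe, Set.mem_preimage, SetLike.mem_coe, map_sub, pushC_fiberVec]
    have h1 := mem_devSpan g (k := k + 1) (u := u ++ [a]) (by simpa using hu)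
    have h2 := mem_devSpan g (k := k + 1) (u := [] ++ [a]) (by simp)
    simpa using Submodule.sub_mem _ h1 h2
  exact this hx

theorem devSpan_stable (g : Q → A → Q) (k : ℕ) (h : devSpan g (k + 1) ≤ devSpan g k) :
    devSpan g (k + 2) ≤ devSpan g (k + 1) := by
  refine Submodule.span_le.2 ?_
  rintro x ⟨u, hu, rfl⟩
  rcases List.eq_nil_or_concat u with rfl | ⟨v, a, rfl⟩
  · simp
  · have h1 := pushC_mem_devSpan g a k _ (h (mem_devSpan g (u := v) (by simpa using hu)))
    have h2 := mem_devSpan g (k := k + 1) (u := [] ++ [a]) (by simp)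
    rw [map_sub, pushC_fiberVec, pushC_fiberVec] at h1
    simpa using Submodule.add_mem _ h1 h2

/-- If a word has `r` nonempty fibres, all of them having constant preimage size, then
unbalanced preimages are witnessed by words of length at most `n - r`. -/
theorem exists_short_card_ne (g : Q → A → Q) (w : List A) (I : Finset Q)
    (hI : ∀ q ∈ I, (preC g w {q}).Nonempty)
    (hfull : ∀ q ∈ I, ∀ u, (preC g u (preC g w {q})).card = (preC g w {q}).card)
    (S : Finset Q) (u : List A) (hu : (preC g u S).card ≠ S.card) :
    ∃ v : List A, v.length ≤ Fintype.card Q - I.card ∧ (preC g v S).card ≠ S.card := by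
  set d := Fintype.card Q - I.card with hd
  by_contra! hc
  let F : (Q → ℚ) →ₗ[ℚ] ({q // q ∈ I} → ℚ) :=
    (LinearMap.funLeft ℚ ℚ (fun q : {q // q ∈ I} => (q : Q))) ∘ₗ pushC g w
  have hF : ∀ x q, F x q = ∑ p ∈ preC g w {(q : Q)}, x p := fun x q => rfl
  have hsurj : LinearMap.range F = ⊤ := by
    rw [LinearMap.range_eq_top]
    intro y
    refine ⟨fun p => if h : stepWordC g p w ∈ I then
      y ⟨_, h⟩ / ((preC g w {stepWordC g p w}).card : ℚ) else 0, ?_⟩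
    ext q
    rw [hF]
    have : ∀ p ∈ preC g w {(q : Q)}, (if h : stepWordC g p w ∈ I then
      y ⟨_, h⟩ / ((preC g w {stepWordC g p w}).card : ℚ) else 0)
        = y q / ((preC g w {(q : Q)}).card : ℚ) := by
      intro p hp
      have hp' : stepWordC g p w = q := by simpa [mem_preC] using hp
      simp [hp']
    rw [Finset.sum_congr rfl this, Finset.sum_const, nsmul_eq_mul]
    have := (hI q q.2).card_pos
    field_simp
  have hker : Module.finrank ℚ (LinearMap.ker F) = d := by
    have := LinearMap.finrank_range_add_finrank_ker F
    rw [hsurj, finrank_top] at this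
    simp at this
    omega
  have hle : ∀ k, devSpan g k ≤ LinearMap.ker F := by
    intro k
    refine Submodule.span_le.2 ?_
    rintro x ⟨v, hv, rfl⟩
    simp only [SetLike.mem_coe, LinearMap.mem_ker]
    ext q
    rw [hF]
    simp only [Pi.sub_apply, Finset.sum_sub_distrib, fiberVec, Pi.zero_apply]
    have h1 := hfull q q.2 v
    rw [card_preC_eq_sum] at h1
    have h2 := card_preC_eq_sum g [] (preC g w {(q : Q)})
    rw [preC_nil] at h2
    rw [sub_eq_zero]
    exact_mod_cast h1.trans h2
  have hall : ∀ k, devSpan g k ≤ devSpan g d := by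
    rcases Submodule.chain_stabilizes (devSpan g) (devSpan_mono g) (devSpan_stable g) d with h | h
    · exact h
    · have heq : devSpan g d = LinearMap.ker F :=
        Submodule.eq_of_le_of_finrank_le (hle d) (by omega)
      intro k
      rw [heq]
      exact hle k
  let φ : (Q → ℚ) →ₗ[ℚ] ℚ :=
    { toFun := fun x => ∑ q ∈ S, x q
      map_add' := fun x y => by simp [Finset.sum_add_distrib]
      map_smul' := fun c x => by simp [Finset.mul_sum] }
  have hφ : ∀ v, φ (fiberVec g v - fiberVec g []) = (preC g v S).card - S.card := by
    intro v
    have h2 := card_preC_eq_sum g [] S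
    rw [preC_nil] at h2
    rw [card_preC_eq_sum g v S, h2]
    simp [φ, fiberVec]
  have hdφ : devSpan g d ≤ LinearMap.ker φ := by
    refine Submodule.span_le.2 ?_
    rintro x ⟨v, hv, rfl⟩
    simp only [SetLike.mem_coe, LinearMap.mem_ker, hφ, hc v hv, sub_self]
  have h0 := hdφ (hall u.length (mem_devSpan g (u := u) le_rfl))
  rw [LinearMap.mem_ker, hφ, sub_eq_zero] at h0
  exact hu (by exact_mod_cast h0)

variable [Fintype A]

/-- Every state of a complete DFA has exactly `|A|` incoming transitions. -/
def IndegreeRegular (g : Q → A → Q) : Prop :=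
  ∀ q, ∑ a : A, (preC g [a] {q}).card = Fintype.card A

theorem IndegreeRegular.sum_card_preC {g : Q → A → Q} (hE : IndegreeRegular g) (S : Finset Q) :
    ∑ a : A, (preC g [a] S).card = ∑ _a : A, S.card := by
  calc ∑ a : A, (preC g [a] S).card = ∑ a : A, ∑ q ∈ S, (preC g [a] {q}).card :=
        Finset.sum_congr rfl fun a _ => card_preC_eq_sum g [a] S
    _ = ∑ q ∈ S, Fintype.card A := by
        rw [Finset.sum_comm]
        exact Finset.sum_congr rfl fun q _ => hE q
    _ = _ := by simp [mul_comm]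

theorem IndegreeRegular.exists_card_le {g : Q → A → Q} (hE : IndegreeRegular g) [Nonempty A]
    (L : ℕ) (S : Finset Q) : ∃ u : List A, u.length = L ∧ S.card ≤ (preC g u S).card := by
  induction L generalizing S with
  | zero => exact ⟨[], rfl, by rw [preC_nil]⟩
  | succ L ih =>
    obtain ⟨a, -, ha⟩ := Finset.exists_le_of_sum_le Finset.univ_nonempty
      (hE.sum_card_preC S).ge
    obtain ⟨u, hu, h⟩ := ih (preC g [a] S)
    exact ⟨u ++ [a], by simp [hu], by rw [preC_append]; exact ha.trans h⟩

theorem IndegreeRegular.card_eq_of_forall_le {g : Q → A → Q} (hE : IndegreeRegular g)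
    (u : List A) (S : Finset Q)
    (h : ∀ v : List A, v.length = u.length → (preC g v S).card ≤ S.card) :
    (preC g u S).card = S.card := by
  induction u using List.reverseRecOn generalizing S with
  | nil => rw [preC_nil]
  | append_singleton u a ih =>
    have : Nonempty A := ⟨a⟩
    have h1 : ∀ b ∈ (Finset.univ : Finset A), (preC g [b] S).card ≤ S.card := by
      intro b _
      obtain ⟨v, hv, hle⟩ := hE.exists_card_le u.length (preC g [b] S)
      rw [← preC_append] at hle
      exact hle.trans (h _ (by simp [hv]))
    have h2 := (Finset.sum_eq_sum_iff_of_le h1).1 (hE.sum_card_preC S) a (Finset.mem_univ a)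
    rw [preC_append, ih, h2]
    intro v hv
    rw [← preC_append, h2]
    exact h _ (by simp [hv])

theorem IndegreeRegular.exists_lt {g : Q → A → Q} (hE : IndegreeRegular g)
    (u : List A) (S : Finset Q) (h : (preC g u S).card ≠ S.card) :
    ∃ v : List A, v.length = u.length ∧ S.card < (preC g v S).card := by
  by_contra! hc
  exact h (hE.card_eq_of_forall_le u S hc)

/-- The rank conjecture for complete Eulerian automata, with the additional information that
the image of the word obtained cannot be compressed any further. -/
theorem exists_short_minRank_word [Nonempty Q] (g : Q → A → Q) (hE : IndegreeRegular g)
    (hsc : ∀ p q : Q, ∃ w : List A, stepWordC g p w = q) :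
    ∃ w : List A, w.length ≤
        (Fintype.card Q - (Finset.univ.image (fun q => stepWordC g q w)).card) ^ 2 ∧
      ∀ p q : Q, ∀ v : List A, stepWordC g p (w ++ v) = stepWordC g q (w ++ v) →
        stepWordC g p w = stepWordC g q w := by
  let im : List A → Finset Q := fun w => Finset.univ.image (fun q => stepWordC g q w)
  have him : ∀ w q, q ∈ im w ↔ (preC g w {q}).Nonempty := by
    intro w q
    simp [im, Finset.Nonempty, mem_preC]
  obtain ⟨w, hw⟩ : ∃ w, ∀ v, (im w).card ≤ (im v).card := by
    exact ⟨Function.argmin fun w => (im w).card,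
      fun v => Function.argmin_le (fun w => (im w).card) v⟩
  -- words with a minimal image are injective on it
  have hinj : ∀ u, (im u).card ≤ (im w).card → ∀ p q : Q, ∀ v : List A,
      stepWordC g p (u ++ v) = stepWordC g q (u ++ v) → stepWordC g p u = stepWordC g q u := by
    intro u hu p q v hpq
    have h1 : im (u ++ v) = (im u).image (fun q => stepWordC g q v) := by
      simp only [im, Finset.image_image]
      congr 1
      ext x
      simp [stepWordC_append]
    have h2 : ((im u).image (fun q => stepWordC g q v)).card = (im u).card :=
      le_antisymm Finset.card_image_le (by rw [← h1]; exact hu.trans (hw _))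
    rw [Finset.card_image_iff] at h2
    rw [stepWordC_append, stepWordC_append] at hpq
    exact h2 (by simp [im]) (by simp [im]) hpq
  -- the maximal fibre size
  obtain ⟨⟨w0, q0⟩, hmax⟩ : ∃ x : List A × Q, ∀ y : List A × Q,
      (preC g y.1 {y.2}).card ≤ (preC g x.1 {x.2}).card := by
    have hb : ∀ y : List A × Q, (preC g y.1 {y.2}).card ≤ Fintype.card Q :=
      fun y => Finset.card_le_univ _
    have hfin : (Set.range fun y : List A × Q => (preC g y.1 {y.2}).card).Finite :=
      (Set.finite_Iic (Fintype.card Q)).subset (by rintro _ ⟨y, rfl⟩; exact hb y)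
    have : Nonempty (List A × Q) := ⟨([], Classical.arbitrary Q)⟩
    obtain ⟨_, ⟨x, rfl⟩, hx⟩ := hfin.exists_maximal (Set.range_nonempty _)
    refine ⟨x, fun y => ?_⟩
    by_contra! hlt
    exact absurd (hx ⟨y, rfl⟩ hlt.le) (by simpa using hlt)
  set m := (preC g w0 {q0}).card
  replace hmax : ∀ u q, (preC g u {q}).card ≤ m := fun u q => hmax (u, q)
  have hpers : ∀ v q, (preC g v {q}).card = m → ∀ u, (preC g u (preC g v {q})).card = m := by
    intro v q hv u
    rw [hE.card_eq_of_forall_le u _ (fun u' _ => ?_), hv]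
    rw [← preC_append, hv]
    exact hmax _ _
  have hmpos : 0 < m := by
    have h1 := hmax [] q0
    rw [preC_nil] at h1
    simpa [Nat.one_le_iff_ne_zero, Nat.pos_iff_ne_zero] using h1
  obtain ⟨p0, hp0⟩ : (preC g w0 {q0}).Nonempty := Finset.card_pos.1 hmpos
  -- nonempty fibres of `w` have maximal size
  have hwfull : ∀ q ∈ im w, (preC g w {q}).card = m := by
    intro q hq
    obtain ⟨x, hx⟩ := hsc q p0
    have hB' : (preC g w (preC g x (preC g w0 {q0}))).card = m := by
      rw [← preC_append]
      exact hpers w0 q0 rfl (w ++ x)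
    refine le_antisymm (hmax _ _) ?_
    rw [← hB']
    refine Finset.card_le_card ?_
    intro p hp
    obtain ⟨p', hp'⟩ := (him w q).1 hq
    rw [mem_preC, Finset.mem_singleton] at hp' ⊢
    rw [← hp']
    refine hinj w le_rfl p p' (x ++ w0) ?_
    rw [← preC_append, ← preC_append, mem_preC, Finset.mem_singleton, List.append_assoc] at hp
    rw [hp, stepWordC_append, hp', stepWordC_append, hx]
    rw [mem_preC, Finset.mem_singleton] at hp0
    exact hp0.symm
  have hsum : ∀ u, ∑ q, (preC g u {q}).card = Fintype.card Q := by
    intro u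
    rw [← card_preC_eq_sum]
    simp [preC]
  have hsum' : ∀ u, ∑ q ∈ im u, (preC g u {q}).card = Fintype.card Q := by
    intro u
    rw [← hsum u]
    refine Finset.sum_subset (Finset.subset_univ _) fun q _ hq => ?_
    rw [him, Finset.not_nonempty_iff_eq_empty] at hq
    simp [hq]
  set r := (im w).card
  have hrm : r * m = Fintype.card Q := by
    rw [← hsum' w, Finset.sum_congr rfl hwfull, Finset.sum_const, smul_eq_mul]
  set d := Fintype.card Q - r with hd
  -- one extension step
  have hstep : ∀ S : Finset Q, S.Nonempty → S.card < m →
      ∃ u : List A, u.length ≤ d ∧ S.card < (preC g u S).card := by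
    intro S hS hSm
    obtain ⟨s, hs⟩ := hS
    obtain ⟨x, hx⟩ := hsc q0 s
    have h1 : m ≤ (preC g (w0 ++ x) S).card := by
      refine Finset.card_le_card fun p hp => ?_
      rw [mem_preC, Finset.mem_singleton] at hp
      rw [mem_preC, stepWordC_append, hp, hx]
      exact hs
    obtain ⟨v, hv, hvne⟩ := exists_short_card_ne g w (im w) (fun q hq => (him w q).1 hq)
      (fun q hq u => by rw [hpers w q (hwfull q hq), hwfull q hq]) S (w0 ++ x) (by omega)
    obtain ⟨u, hu, hlt⟩ := hE.exists_lt v S hvne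
    exact ⟨u, by omega, hlt⟩
  -- extending a fibre to maximal size
  have hgrow : ∀ k : ℕ, ∀ v q, (preC g v {q}).Nonempty → m - (preC g v {q}).card ≤ k →
      ∃ u : List A, u.length ≤ k * d ∧ (preC g (u ++ v) {q}).card = m := by
    intro k
    induction k with
    | zero =>
      intro v q _ hk
      exact ⟨[], by simp, le_antisymm (hmax _ _) (by simpa using by omega)⟩
    | succ k ih =>
      intro v q hne hk
      by_cases hlt : (preC g v {q}).card < m
      · obtain ⟨u, hu, hul⟩ := hstep _ hne hlt
        rw [← preC_append] at hul
        obtain ⟨u', hu', h⟩ := ih (u ++ v) q (Finset.card_pos.1 (by omega)) (by omega)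
        refine ⟨u' ++ u, ?_, by rw [List.append_assoc]; exact h⟩
        rw [List.length_append, Nat.succ_mul]
        omega
      · exact ⟨[], by simp, le_antisymm (hmax _ _) (by simpa using hlt)⟩
  -- extending the fibres one after another
  have hmain : ∀ j ≤ r, ∃ (v : List A) (J : Finset Q), v.length ≤ j * ((m - 1) * d) ∧
      J.card = j ∧ ∀ q ∈ J, (preC g v {q}).card = m := by
    intro j
    induction j with
    | zero => exact fun _ => ⟨[], ∅, by simp, rfl, by simp⟩
    | succ j ih =>
      intro hj
      obtain ⟨v, J, hv, hJ, hJm⟩ := ih (by omega)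
      obtain ⟨q, hqJ, hq⟩ : ∃ q, q ∉ J ∧ (preC g v {q}).Nonempty := by
        by_contra! hc
        have h1 := hsum v
        rw [← Finset.sum_subset (Finset.subset_univ J) (fun q _ hq => by simp [hc q hq]),
          Finset.sum_congr rfl hJm, Finset.sum_const, smul_eq_mul, hJ, ← hrm] at h1
        have := Nat.eq_of_mul_eq_mul_right hmpos h1
        omega
      obtain ⟨u, hu, huq⟩ := hgrow (m - 1) v q hq (by have := hq.card_pos; omega)
      refine ⟨u ++ v, insert q J, ?_, by rw [Finset.card_insert_of_notMem hqJ, hJ], ?_⟩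
      · rw [List.length_append, Nat.succ_mul]
        omega
      · intro p hp
        rcases Finset.mem_insert.1 hp with rfl | hp
        · exact huq
        · rw [preC_append]
          exact hpers v p (hJm p hp) u
  obtain ⟨v, J, hv, hJ, hJm⟩ := hmain r le_rfl
  have himv : im v ⊆ J := by
    intro q hq
    by_contra hqJ
    have h1 : ∑ p ∈ insert q J, (preC g v {p}).card ≤ Fintype.card Q := by
      rw [← hsum v]
      exact Finset.sum_le_sum_of_subset (Finset.subset_univ _)
    rw [Finset.sum_insert hqJ, Finset.sum_congr rfl hJm, Finset.sum_const, smul_eq_mul, hJ,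
      hrm] at h1
    have := ((him v q).1 hq).card_pos
    omega
  have hcard : (im v).card = r := le_antisymm (hJ ▸ Finset.card_le_card himv) (hw v)
  refine ⟨v, ?_, fun p q x h => hinj v hcard.le p q x h⟩
  change v.length ≤ (Fintype.card Q - (im v).card) ^ 2
  rw [hcard]
  refine hv.trans (le_of_eq ?_)
  have h1 : r * (m - 1) = d := by rw [Nat.mul_sub, hrm, mul_one]
  rw [← mul_assoc, h1, sq]

end Complete

section Partial

variable {Q A : Type*}

theorem stepWord_append (δ : Q → A → Option Q) (q : Q) (u v : List A) :
    stepWord δ q (u ++ v) = (stepWord δ q u).bind (fun p => stepWord δ p v) := by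
  induction u generalizing q with
  | nil => rfl
  | cons a u ih =>
    simp only [List.cons_append, stepWord]
    cases δ q a with
    | none => rfl
    | some p => exact ih p

theorem img_append (δ : Q → A → Option Q) (S : Set Q) (u v : List A) :
    img δ S (u ++ v) = img δ (img δ S u) v := by
  ext p
  simp only [img, Set.mem_ofPred_eq, stepWord_append, Option.bind_eq_some_iff]
  grind

theorem img_mono (δ : Q → A → Option Q) {S T : Set Q} (h : S ⊆ T) (w : List A) :
    img δ S w ⊆ img δ T w := by
  rintro p ⟨q, hq, hp⟩
  exact ⟨q, h hq, hp⟩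

theorem stepWordC_fixDelta (δ : Q → A → Option Q) {q p : Q} {w : List A}
    (h : stepWord δ q w = some p) : stepWordC (fixDelta δ) q w = p := by
  induction w generalizing q with
  | nil => simpa [stepWord, stepWordC] using h
  | cons a w ih =>
    rw [stepWord, Option.bind_eq_some_iff] at h
    obtain ⟨q', hq', hp⟩ := h
    have := ih hp
    simpa [stepWordC, fixDelta, hq'] using this

theorem imgC_append (g : Q → A → Q) (S : Set Q) (u v : List A) :
    imgC g S (u ++ v) = imgC g (imgC g S u) v := by
  simp only [imgC, Set.image_image]
  exact Set.image_congr fun q _ => stepWordC_append g q u v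

/-- Every word can be thinned out so that its partial action on a nonempty set becomes nonempty
and is contained in the action of the original word in the fixing automaton. -/
theorem exists_img_subset_imgC_fixDelta (δ : Q → A → Option Q) (w : List A) (S : Set Q)
    (hS : S.Nonempty) : ∃ v : List A, v.length ≤ w.length ∧ (img δ S v).Nonempty ∧
      img δ S v ⊆ imgC (fixDelta δ) S w := by
  induction w generalizing S with
  | nil =>
    have h : img δ S [] = S := by
      ext p
      simp [img, stepWord]
    refine ⟨[], le_rfl, by rwa [h], ?_⟩
    rw [h]
    exact fun p hp => ⟨p, hp, rfl⟩
  | cons a w ih =>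
    have hcons : imgC (fixDelta δ) S (a :: w) = imgC (fixDelta δ) (imgC (fixDelta δ) S [a]) w :=
      imgC_append _ S [a] w
    by_cases h : (img δ S [a]).Nonempty
    · obtain ⟨v, hv, hne, hsub⟩ := ih _ h
      refine ⟨[a] ++ v, by simpa using hv, ?_, ?_⟩
      · rwa [img_append]
      · rw [img_append, hcons]
        refine hsub.trans (Set.image_mono ?_)
        rintro p ⟨q, hq, hp⟩
        exact ⟨q, hq, stepWordC_fixDelta δ hp⟩
    · obtain ⟨v, hv, hne, hsub⟩ := ih S hS
      refine ⟨v, hv.trans (by simp), hne, hsub.trans ?_⟩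
      rw [hcons]
      refine Set.image_mono fun q hq => ⟨q, hq, ?_⟩
      cases hqa : δ q a with
      | none => simp [stepWordC, fixDelta, hqa]
      | some p => exact absurd ⟨p, q, hq, by simp [stepWord, hqa]⟩ h

theorem indegreeRegular_fixDelta [Fintype Q] [Fintype A] (δ : Q → A → Option Q)
    (heul : ∀ q : Q,
      {a : A | (δ q a).isSome}.ncard = {pa : Q × A | δ pa.1 pa.2 = some q}.ncard) :
    IndegreeRegular (fixDelta δ) := by
  intro q
  have h1 : ∀ a, (preC (fixDelta δ) [a] {q}).card
      = (∑ p, if δ p a = some q then 1 else 0) + if (δ q a).isSome then 0 else 1 := by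
    intro a
    have h2 : (if (δ q a).isSome then 0 else 1)
        = ∑ p, if p = q ∧ ¬ (δ q a).isSome then 1 else 0 := by
      by_cases h : (δ q a).isSome <;> simp [h]
    rw [h2, ← Finset.sum_add_distrib, preC, Finset.card_filter]
    refine Finset.sum_congr rfl fun p _ => ?_
    by_cases hpq : p = q
    · subst hpq
      cases hp : δ p a <;> simp [stepWordC, fixDelta, hp]
    · cases hp : δ p a <;> simp [stepWordC, fixDelta, hp, hpq]
  have h3 : {pa : Q × A | δ pa.1 pa.2 = some q}.ncard
      = ∑ a, ∑ p, if δ p a = some q then 1 else 0 := by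
    rw [← Fintype.sum_prod_type_right' (fun p a => if δ p a = some q then 1 else 0),
      ← Finset.card_filter, ← Set.ncard_coe_finset]
    simp
  have h4 : {a : A | (δ q a).isSome}.ncard = ∑ a, if (δ q a).isSome then 1 else 0 := by
    rw [← Finset.card_filter, ← Set.ncard_coe_finset]
    simp
  rw [Finset.sum_congr rfl fun a _ => h1 a, Finset.sum_add_distrib, ← h3, ← heul q, h4,
    ← Finset.sum_add_distrib, Fintype.card_eq_sum_ones]
  refine Finset.sum_congr rfl fun a _ => ?_
  split_ifs <;> rfl

/-- The indicator vector of the domain of a word. -/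
noncomputable def domVec (δ : Q → A → Option Q) (u : List A) : Q → ℚ :=
  fun q => if (stepWord δ q u).isSome then 1 else 0

/-- Pull-back of rational functions along a letter, extended by zero. -/
noncomputable def pullLetter (δ : Q → A → Option Q) (a : A) : (Q → ℚ) →ₗ[ℚ] (Q → ℚ) where
  toFun x q := (δ q a).elim 0 x
  map_add' x y := by
    ext q
    cases h : δ q a <;> simp [h]
  map_smul' c x := by
    ext q
    cases h : δ q a <;> simp [h]

theorem pullLetter_domVec (δ : Q → A → Option Q) (a : A) (u : List A) :
    pullLetter δ a (domVec δ u) = domVec δ (a :: u) := by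
  ext q
  cases h : δ q a <;> simp [pullLetter, domVec, stepWord, h]

/-- The span of the domain indicators of words of length at most `k`. -/
noncomputable def domSpan (δ : Q → A → Option Q) (k : ℕ) : Submodule ℚ (Q → ℚ) :=
  Submodule.span ℚ {x | ∃ u : List A, u.length ≤ k ∧ x = domVec δ u}

theorem domSpan_mono (δ : Q → A → Option Q) : Monotone (domSpan δ) := by
  intro i j hij
  refine Submodule.span_mono ?_
  rintro x ⟨u, hu, rfl⟩
  exact ⟨u, hu.trans hij, rfl⟩

theorem domVec_mem_domSpan (δ : Q → A → Option Q) {k : ℕ} {u : List A} (hu : u.length ≤ k) :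
    domVec δ u ∈ domSpan δ k :=
  Submodule.subset_span ⟨u, hu, rfl⟩

theorem domSpan_stable (δ : Q → A → Option Q) (k : ℕ) (h : domSpan δ (k + 1) ≤ domSpan δ k) :
    domSpan δ (k + 2) ≤ domSpan δ (k + 1) := by
  refine Submodule.span_le.2 ?_
  rintro x ⟨u, hu, rfl⟩
  rcases u with _ | ⟨a, u⟩
  · exact domVec_mem_domSpan δ (by simp)
  · have h1 : domSpan δ k ≤ (domSpan δ (k + 1)).comap (pullLetter δ a) := by
      refine Submodule.span_le.2 ?_
      rintro x ⟨v, hv, rfl⟩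
      simp only [Submodule.comap_coe, Set.mem_preimage, SetLike.mem_coe, pullLetter_domVec]
      exact domVec_mem_domSpan δ (by simpa using hv)
    have h2 := h1 (h (domVec_mem_domSpan δ (u := u) (by simpa using hu)))
    rwa [Submodule.mem_comap, pullLetter_domVec] at h2

/-- Two separable states of a set `T` yield a word of length at most `n - |T| + 1` which is
defined at some, but not all, states of `T`. -/
theorem exists_short_separating_word [Fintype Q] (δ : Q → A → Option Q) (T : Finset Q) {p q : Q}
    (hp : p ∈ T) (hq : q ∈ T) (hpq : ¬ Insep δ p q) :
    ∃ v : List A, v.length ≤ Fintype.card Q - T.card + 1 ∧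
      (∃ s ∈ T, (stepWord δ s v).isSome) ∧ ∃ s ∈ T, ¬ (stepWord δ s v).isSome := by
  set d := Fintype.card Q - T.card + 1 with hd
  by_contra! hc
  let F : (Q → ℚ) →ₗ[ℚ] ({s // s ∈ T.erase p} → ℚ) :=
    { toFun := fun x s => x s - x p
      map_add' := fun x y => by
        ext s
        simp only [Pi.add_apply]
        ring
      map_smul' := fun c x => by
        ext s
        simp only [Pi.smul_apply, smul_eq_mul, RingHom.id_apply]
        ring }
  have hF : ∀ x s, F x s = x s - x p := fun x s => rfl
  have hsurj : LinearMap.range F = ⊤ := by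
    rw [LinearMap.range_eq_top]
    intro y
    refine ⟨fun s => if h : s ∈ T.erase p then y ⟨s, h⟩ else 0, ?_⟩
    ext s
    rw [hF, dif_pos s.2, dif_neg (Finset.notMem_erase p T), sub_zero]
  have hcard := Finset.card_erase_of_mem hp
  have hTpos := Finset.card_pos.2 ⟨p, hp⟩
  have hTle := Finset.card_le_univ T
  have hker : Module.finrank ℚ (LinearMap.ker F) = d := by
    have := LinearMap.finrank_range_add_finrank_ker F
    rw [hsurj, finrank_top, Module.finrank_fintype_fun_eq_card,
      Module.finrank_fintype_fun_eq_card, Fintype.card_coe] at this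
    omega
  have hle : domSpan δ d ≤ LinearMap.ker F := by
    refine Submodule.span_le.2 ?_
    rintro x ⟨v, hv, rfl⟩
    simp only [SetLike.mem_coe, LinearMap.mem_ker]
    ext s
    have hsT := Finset.mem_of_mem_erase s.2
    have h1 := hc v hv
    have h2 : (stepWord δ s v).isSome ↔ (stepWord δ p v).isSome :=
      ⟨fun h => h1 ⟨s, hsT, h⟩ p hp, fun h => h1 ⟨p, hp, h⟩ s hsT⟩
    rw [hF]
    simp [domVec, h2]
  have hone : 1 ≤ Module.finrank ℚ (domSpan δ 0) := by
    rw [Nat.one_le_iff_ne_zero, ← Nat.pos_iff_ne_zero]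
    refine Module.finrank_pos_iff_exists_ne_zero.2
      ⟨⟨domVec δ [], domVec_mem_domSpan δ le_rfl⟩, fun h => ?_⟩
    have := congrFun (congrArg Subtype.val h) p
    simp [domVec, stepWord] at this
  have hall : ∀ k, domSpan δ k ≤ domSpan δ d := by
    rcases Submodule.chain_stabilizes (domSpan δ) (domSpan_mono δ) (domSpan_stable δ) d with h | h
    · exact h
    · have := Submodule.finrank_mono hle
      omega
  refine hpq fun u => ?_
  have h0 := hle (hall u.length (domVec_mem_domSpan δ (u := u) le_rfl))
  by_cases hqp : q = p
  · rw [hqp]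
  have h1 := congrFun (LinearMap.mem_ker.1 h0) ⟨q, Finset.mem_erase.2 ⟨hqp, hq⟩⟩
  rw [hF] at h1
  by_cases h2 : (stepWord δ p u).isSome <;> by_cases h3 : (stepWord δ q u).isSome <;>
    simp [domVec, h2, h3] at h1 ⊢

/-- A set of pairwise inseparable states which no word merges is at most as large as any
nonempty image. -/
theorem ncard_le_of_insep [Fintype Q] (δ : Q → A → Option Q) (hsc : StronglyConnected δ)
    (T : Set Q) (hT : T.Nonempty) (hins : ∀ p ∈ T, ∀ q ∈ T, Insep δ p q)
    (hinj : ∀ v : List A, Set.InjOn (fun q => stepWordC (fixDelta δ) q v) T)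
    (z : List A) (hz : (img δ Set.univ z).Nonempty) :
    T.ncard ≤ (img δ Set.univ z).ncard := by
  obtain ⟨s', s, -, hs⟩ := hz
  obtain ⟨t, ht⟩ := hT
  obtain ⟨v, hv⟩ := hsc t s
  have hdef : ∀ p ∈ T, (stepWord δ p (v ++ z)).isSome := by
    intro p hp
    rw [hins p hp t ht (v ++ z), stepWord_append, hv]
    simp [hs]
  refine Set.ncard_le_ncard_of_injOn (fun q => stepWordC (fixDelta δ) q (v ++ z)) ?_
    (hinj (v ++ z)) (Set.toFinite _)
  intro p hp
  obtain ⟨p', hp'⟩ := Option.isSome_iff_exists.1 (hdef p hp)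
  have h1 : p' ∈ img δ T (v ++ z) := ⟨p, hp, hp'⟩
  rw [img_append] at h1
  have h2 := img_mono δ (Set.subset_univ (img δ T v)) z h1
  change stepWordC (fixDelta δ) p (v ++ z) ∈ _
  rwa [stepWordC_fixDelta δ hp']

theorem ncard_img_le [Finite Q] (δ : Q → A → Option Q) (T : Set Q) (v : List A) :
    (img δ T v).ncard ≤ {q ∈ T | (stepWord δ q v).isSome}.ncard := by
  have h : img δ T v ⊆
      (fun q => stepWordC (fixDelta δ) q v) '' {q ∈ T | (stepWord δ q v).isSome} := by
    rintro p ⟨q, hq, hp⟩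
    exact ⟨q, ⟨hq, by simp [hp]⟩, stepWordC_fixDelta δ hp⟩
  exact (Set.ncard_le_ncard h (Set.toFinite _)).trans (Set.ncard_image_le (Set.toFinite _))

/-- A word whose nonempty image is not merged by any word can be prolonged, within the quadratic
length budget, to a word of minimal nonzero rank. -/
theorem exists_word_of_minRank [Fintype Q] (δ : Q → A → Option Q) (hsc : StronglyConnected δ)
    (z : List A) (hz : (img δ Set.univ z).Nonempty)
    (hmin : ∀ w, (img δ Set.univ w).Nonempty →
      (img δ Set.univ z).ncard ≤ (img δ Set.univ w).ncard)
    (t : ℕ) (w : List A) (ht : (img δ Set.univ w).ncard = t)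
    (hne : (img δ Set.univ w).Nonempty)
    (hinj : ∀ v : List A,
      Set.InjOn (fun q => stepWordC (fixDelta δ) q v) (img δ Set.univ w))
    (hlen : w.length ≤ (Fintype.card Q - t) ^ 2) :
    ∃ w : List A, (img δ Set.univ w).ncard = (img δ Set.univ z).ncard ∧
      w.length ≤ (Fintype.card Q - (img δ Set.univ z).ncard) ^ 2 := by
  induction t using Nat.strong_induction_on generalizing w with
  | _ t ih =>
    rcases (hmin w hne).eq_or_lt with heq | hlt
    · exact ⟨w, heq.symm, by rw [heq, ht]; exact hlen⟩
    set T := img δ Set.univ w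
    obtain ⟨p, hp, q, hq, hpq⟩ : ∃ p ∈ T, ∃ q ∈ T, ¬ Insep δ p q := by
      by_contra! hc
      exact absurd (ncard_le_of_insep δ hsc T hne hc hinj z hz) (by omega)
    have hTcard : T.toFinset.card = t := by rw [← Set.ncard_eq_toFinset_card', ht]
    obtain ⟨v, hv, ⟨s, hs, hsv⟩, ⟨s', hs', hsv'⟩⟩ := exists_short_separating_word δ T.toFinset
      (Set.mem_toFinset.2 hp) (Set.mem_toFinset.2 hq) hpq
    rw [Set.mem_toFinset] at hs hs'
    have himg : img δ Set.univ (w ++ v) = img δ T v := img_append δ _ w v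
    have hlt' : (img δ Set.univ (w ++ v)).ncard < t := by
      rw [himg, ← ht]
      exact (ncard_img_le δ T v).trans_lt
        (Set.ncard_lt_ncard ⟨fun x hx => hx.1, fun h => hsv' (h hs').2⟩ (Set.toFinite _))
    have htn : t ≤ Fintype.card Q := hTcard ▸ Finset.card_le_univ _
    refine ih _ hlt' (w ++ v) rfl ?_ ?_ ?_
    · obtain ⟨x, hx⟩ := Option.isSome_iff_exists.1 hsv
      rw [himg]
      exact ⟨x, s, hs, hx⟩
    · intro u
      rw [himg]
      rintro _ ⟨x, hx, hxv⟩ _ ⟨y, hy, hyv⟩ h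
      rw [← stepWordC_fixDelta δ hxv, ← stepWordC_fixDelta δ hyv] at h ⊢
      simp only [← stepWordC_append] at h
      rw [hinj (v ++ u) hx hy h]
    · rw [hTcard] at hv
      have h1 : Fintype.card Q - t + 1 ≤ Fintype.card Q - (img δ Set.univ (w ++ v)).ncard := by
        omega
      refine le_trans ?_ (Nat.pow_le_pow_left h1 2)
      rw [List.length_append]
      nlinarith

end Partial

/-- The rank conjecture holds for partial Eulerian automata: if `A` is
strongly connected and, at every state, the number of defined outgoing transitions equals
the number of incoming transitions, then there is a word of the minimal non-zero rank `r`
of length at most `(n − r)²`. -/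
theorem stmt7 {Q A : Type*} [Fintype Q] [Fintype A] [Nonempty Q] (δ : Q → A → Option Q)
    (hsc : StronglyConnected δ)
    (heul : ∀ q : Q,
      {a : A | (δ q a).isSome}.ncard = {pa : Q × A | δ pa.1 pa.2 = some q}.ncard)
    (n r : ℕ) (hn : n = Fintype.card Q)
    (hr : r = sInf {k : ℕ | ∃ w : List A, (img δ Set.univ w).ncard = k ∧ k ≠ 0}) :
    ∃ w : List A, (img δ Set.univ w).ncard = r ∧ w.length ≤ (n - r) ^ 2 := by
  have hne : {k : ℕ | ∃ w : List A, (img δ Set.univ w).ncard = k ∧ k ≠ 0}.Nonempty := by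
    refine ⟨_, [], rfl, ?_⟩
    rw [← Nat.pos_iff_ne_zero, Set.ncard_pos (Set.toFinite _)]
    obtain ⟨q⟩ := ‹Nonempty Q›
    exact ⟨q, q, Set.mem_univ q, rfl⟩
  obtain ⟨z, hz, hz0⟩ := Nat.sInf_mem hne
  rw [← hr] at hz hz0
  obtain ⟨w, hw, hwinj⟩ := exists_short_minRank_word (fixDelta δ)
    (indegreeRegular_fixDelta δ heul)
    (fun p q => (hsc p q).imp fun _ h => stepWordC_fixDelta δ h)
  obtain ⟨v, hv, hvne, hsub⟩ := exists_img_subset_imgC_fixDelta δ w Set.univ Set.univ_nonempty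
  subst hz hn
  refine exists_word_of_minRank δ hsc z ?_ ?_ _ v rfl hvne ?_ ?_
  · exact (Set.ncard_pos (Set.toFinite _)).1 (Nat.pos_of_ne_zero hz0)
  · intro u hu
    rw [hr]
    exact Nat.sInf_le ⟨u, rfl, ((Set.ncard_pos (Set.toFinite _)).2 hu).ne'⟩
  · intro u x hx y hy h
    obtain ⟨p, -, rfl⟩ := hsub hx
    obtain ⟨q, -, rfl⟩ := hsub hy
    simp only [← stepWordC_append] at h
    exact hwinj p q u h
  · refine hv.trans (hw.trans (Nat.pow_le_pow_left (Nat.sub_le_sub_left ?_ _) 2))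
    rw [← Set.ncard_coe_finset]
    refine Set.ncard_le_ncard (hsub.trans ?_) (Set.toFinite _)
    simp [imgC]
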